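/- arXiv:2410.08096 — 3 statements merged into one kernel-verified Lean document; each statement's English description precedes it below -/
import Mathlib

section
/- Let h : ℝᵖ → ℝ be continuously differentiable with gradient ∇h, let F : ℝᵖ → ℝᵖ, and let γ ≥ 0. Suppose that ⟨∇h(x), F(x)⟩ ≥ -γ·h(x) for every x ∈ ℝᵖ. If y : ℝ → ℝᵖ is differentiable at every t ≥ 0 with y'(t) = F(y(t)) for all t ≥ 0, and h(y(0)) ≥ 0, then h(y(t)) ≥ 0 for all t ≥ 0; i.e., the trajectory remains in the safe set S = {x | h(x) ≥ 0}. -/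
open RealInnerProductSpace

/-- Comparison principle: if `u' ≥ -γ u` on `[0, ∞)` and `u 0 ≥ 0`, then `u ≥ 0` on `[0, ∞)`. -/
theorem nonneg_of_hasDerivAt_ge_neg_mul {u u' : ℝ → ℝ} {γ : ℝ}
    (hu : ∀ t, 0 ≤ t → HasDerivAt u (u' t) t) (hu' : ∀ t, 0 ≤ t → -γ * u t ≤ u' t)
    (h0 : 0 ≤ u 0) {t : ℝ} (ht : 0 ≤ t) : 0 ≤ u t := by
  have hd (s : ℝ) (hs : 0 ≤ s) : HasDerivAt (fun s => Real.exp (γ * s) * u s)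
      (Real.exp (γ * s) * (γ * 1) * u s + Real.exp (γ * s) * u' s) s :=
    ((hasDerivAt_id s).const_mul γ).exp.mul (hu s hs)
  have hmono : MonotoneOn (fun s => Real.exp (γ * s) * u s) (Set.Ici 0) := by
    refine monotoneOn_of_hasDerivWithinAt_nonneg (convex_Ici 0)
      (fun s hs => (hd s hs).continuousAt.continuousWithinAt)
      (fun s hs => (hd s (interior_subset hs)).hasDerivWithinAt) fun s hs => ?_
    have := mul_nonneg (Real.exp_pos (γ * s)).le
      (sub_nonneg.2 (hu' s (interior_subset hs)))
    linarith
  have hle : u 0 ≤ Real.exp (γ * t) * u t := by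
    simpa using hmono Set.self_mem_Ici ht ht
  exact nonneg_of_mul_nonneg_right (h0.trans hle) (Real.exp_pos _)

/-- ICBF forward invariance: if the closed-loop vector field `F` satisfies the
barrier condition `⟪∇h x, F x⟫ ≥ -γ·h x` everywhere, then any trajectory of
`y' = F (y)` starting in the safe set `S = {x | h x ≥ 0}` remains in it. -/
theorem stmt_1 (p : ℕ) (h : EuclideanSpace ℝ (Fin p) → ℝ)
    (hC : ContDiff ℝ 1 h)
    (F : EuclideanSpace ℝ (Fin p) → EuclideanSpace ℝ (Fin p))
    (γ : ℝ) (hγ : 0 ≤ γ)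
    (hbar : ∀ x : EuclideanSpace ℝ (Fin p), ⟪gradient h x, F x⟫ ≥ -γ * h x)
    (y : ℝ → EuclideanSpace ℝ (Fin p))
    (hy : ∀ t : ℝ, 0 ≤ t → HasDerivAt y (F (y t)) t)
    (h0 : h (y 0) ≥ 0) :
    ∀ t : ℝ, 0 ≤ t → h (y t) ≥ 0 := by
  intro t ht
  refine nonneg_of_hasDerivAt_ge_neg_mul (u := fun s => h (y s))
    (u' := fun s => ⟪gradient h (y s), F (y s)⟫)
    (fun s hs => ?_) (fun s _ => hbar (y s)) h0 ht
  have hgrad := (hC.differentiable one_ne_zero (y s)).hasGradientAt.hasFDerivAt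
  exact hgrad.comp_hasDerivAt s (hy s hs)
end

section
/- (Theorem 1, RICBF safety.) Let h : ℝᵖ → ℝ be continuously differentiable with gradient ∇h, let ẏ₀, σ : ℝᵖ → ℝᵖ, let B₀ : ℝᵐ → ℝᵖ be a linear map, let φ : ℝᵖ → ℝ, and let γ ≥ 0. Let k : ℝᵖ → ℝᵐ be a feedback controller such that for every x ∈ ℝᵖ: (i) ⟨∇h(x), ẏ₀(x) + B₀ k(x)⟩ - φ(x) ≥ -γ·h(x) (the robust incremental barrier condition), and (ii) ⟨∇h(x), σ(x)⟩ + φ(x) ≥ 0 (the compensation condition). Then for every y : ℝ → ℝᵖ differentiable at each t ≥ 0 with y'(t) = ẏ₀(y(t)) + B₀ k(y(t)) + σ(y(t)) for all t ≥ 0 and h(y(0)) ≥ 0, it holds that h(y(t)) ≥ 0 for all t ≥ 0. -/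
open RealInnerProductSpace

/-- A Grönwall-type comparison: if `u' ≥ -γ u` on `[0, ∞)` and `u 0 ≥ 0`, then `u` stays
nonnegative on `[0, ∞)`. -/
theorem nonneg_of_hasDerivAt_of_neg_mul_le {u u' : ℝ → ℝ} {γ : ℝ}
    (hu : ∀ t : ℝ, 0 ≤ t → HasDerivAt u (u' t) t)
    (hle : ∀ t : ℝ, 0 ≤ t → -γ * u t ≤ u' t) (h0 : 0 ≤ u 0) {t : ℝ} (ht : 0 ≤ t) :
    0 ≤ u t := by
  have hd : ∀ s : ℝ, 0 ≤ s → HasDerivAt (fun s => Real.exp (γ * s) * u s)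
      (Real.exp (γ * s) * (γ * u s + u' s)) s := by
    intro s hs
    have he : HasDerivAt (fun s : ℝ => Real.exp (γ * s)) (Real.exp (γ * s) * γ) s := by
      simpa using ((hasDerivAt_id s).const_mul γ).exp
    exact (he.mul (hu s hs)).congr_deriv (by ring)
  have hmono : MonotoneOn (fun s => Real.exp (γ * s) * u s) (Set.Ici 0) := by
    refine monotoneOn_of_hasDerivWithinAt_nonneg (convex_Ici 0)
      (fun s hs => (hd s hs).continuousAt.continuousWithinAt)
      (fun s hs => (hd s (interior_subset hs)).hasDerivWithinAt) fun s hs => ?_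
    have := hle s (interior_subset hs)
    exact mul_nonneg (Real.exp_pos _).le (by linarith)
  have key : Real.exp (γ * 0) * u 0 ≤ Real.exp (γ * t) * u t :=
    hmono Set.self_mem_Ici ht ht
  rw [mul_zero, Real.exp_zero, one_mul] at key
  exact nonneg_of_mul_nonneg_right (h0.trans key) (Real.exp_pos _)

/-- Theorem 1 (RICBF safety): a controller `k` satisfying the robust incremental
barrier condition, together with the compensation condition on `σ` and `φ`,
renders the closed-loop system `y' = ydot₀(y) + B₀ k(y) + σ(y)` forward invariant
in the safe set `S = {x | h x ≥ 0}`. -/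
theorem stmt_3 (p m : ℕ) (h : EuclideanSpace ℝ (Fin p) → ℝ)
    (hC : ContDiff ℝ 1 h)
    (ydot₀ σ : EuclideanSpace ℝ (Fin p) → EuclideanSpace ℝ (Fin p))
    (B₀ : EuclideanSpace ℝ (Fin m) →ₗ[ℝ] EuclideanSpace ℝ (Fin p))
    (φ : EuclideanSpace ℝ (Fin p) → ℝ)
    (γ : ℝ) (hγ : 0 ≤ γ)
    (k : EuclideanSpace ℝ (Fin p) → EuclideanSpace ℝ (Fin m))
    (hk : ∀ x : EuclideanSpace ℝ (Fin p),
      ⟪gradient h x, ydot₀ x + B₀ (k x)⟫ - φ x ≥ -γ * h x)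
    (hcomp : ∀ x : EuclideanSpace ℝ (Fin p), ⟪gradient h x, σ x⟫ + φ x ≥ 0) :
    ∀ y : ℝ → EuclideanSpace ℝ (Fin p),
      (∀ t : ℝ, 0 ≤ t → HasDerivAt y (ydot₀ (y t) + B₀ (k (y t)) + σ (y t)) t) →
      h (y 0) ≥ 0 →
      ∀ t : ℝ, 0 ≤ t → h (y t) ≥ 0 := by
  intro y hy h0 t ht
  have hd : ∀ s : ℝ, 0 ≤ s → HasDerivAt (fun s => h (y s))
      ⟪gradient h (y s), ydot₀ (y s) + B₀ (k (y s)) + σ (y s)⟫ s := by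
    intro s hs
    have hg : HasGradientAt h (gradient h (y s)) (y s) :=
      (hC.differentiable one_ne_zero (y s)).hasGradientAt
    exact hg.hasFDerivAt.comp_hasDerivAt s (hy s hs)
  refine nonneg_of_hasDerivAt_of_neg_mul_le (γ := γ) hd (fun s _ => ?_) h0 ht
  rw [inner_add_right]
  linarith [hk (y s), hcomp (y s)]
end

section
/- (Theorem 2, MRICBF safety.) Let h : ℝᵖ → ℝ be continuously differentiable with gradient ∇h, let ẏ₀, σ : ℝᵖ → ℝᵖ, let B₀ : ℝᵐ → ℝᵖ be a linear map, let φ : ℝᵖ → ℝ, and let γ ≥ 0. Assume the maps L₁(x) = ⟨∇h(x), ẏ₀(x)⟩, L₂(x) = (Δu ↦ ⟨∇h(x), B₀Δu⟩) (valued in linear functionals on ℝᵐ with the operator norm), L₃(x) = φ(x), and A(x) = γ·h(x) are Lipschitz with constants κ₁, κ₂, κ₃, κ₄ respectively. Let q : ℝᵖ → ℝᵖ be the measurement map and e : ℝᵖ → ℝ a bound with ‖q(x) - x‖ ≤ e(x) for all x, and let k : ℝᵖ → ℝᵐ be a controller. Assume for every x ∈ ℝᵖ: (i) L₁(q(x))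 + L₂(q(x))(k(q(x))) - L₃(q(x)) - (κ₁ + κ₃ + κ₄)·e(x) - κ₂·e(x)·‖k(q(x))‖ ≥ -γ·h(q(x)) (the measurement-robust barrier condition, with margins a(x) = (κ₁+κ₃+κ₄)e(x) and b(x) = κ₂ e(x)), and (ii) ⟨∇h(x), σ(x)⟩ + φ(x) ≥ 0 (the compensation condition). Then for every y : ℝ → ℝᵖ differentiable at each t ≥ 0 with y'(t) = ẏ₀(y(t)) + B₀ k(q(y(t))) + σ(y(t)) for all t ≥ 0 and h(y(0)) ≥ 0, it holds that h(y(t)) ≥ 0 for all t ≥ 0. -/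
open RealInnerProductSpace

/-- A function with `f' ≥ -γ f` on `[0, ∞)` which starts nonnegative stays nonnegative. -/
theorem nonneg_of_hasDerivAt_ge_neg_mul_s7 {f f' : ℝ → ℝ} {γ : ℝ}
    (hf : ∀ t, 0 ≤ t → HasDerivAt f (f' t) t) (hf' : ∀ t, 0 ≤ t → -γ * f t ≤ f' t)
    (h0 : 0 ≤ f 0) {t : ℝ} (ht : 0 ≤ t) : 0 ≤ f t := by
  have hd : ∀ s, 0 ≤ s → HasDerivAt (fun s => Real.exp (γ * s) * f s)
      (Real.exp (γ * s) * γ * f s + Real.exp (γ * s) * f' s) s := fun s hs => by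
    have hlin : HasDerivAt (fun s : ℝ => γ * s) γ s := by
      simpa using (hasDerivAt_id s).const_mul γ
    exact hlin.exp.mul (hf s hs)
  have hmono : MonotoneOn (fun s => Real.exp (γ * s) * f s) (Set.Ici 0) := by
    refine monotoneOn_of_deriv_nonneg (convex_Ici 0)
      (fun s hs => (hd s hs).continuousAt.continuousWithinAt)
      (fun s hs => (hd s (interior_subset hs)).differentiableAt.differentiableWithinAt)
      fun s hs => ?_
    have hs0 : 0 ≤ s := interior_subset hs
    rw [(hd s hs0).deriv]
    have := mul_nonneg (Real.exp_pos (γ * s)).le (by linarith [hf' s hs0] : 0 ≤ γ * f s + f' s)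
    linarith
  have hle : 0 ≤ Real.exp (γ * t) * f t := by
    have := hmono Set.self_mem_Ici ht ht
    simp only [mul_zero, Real.exp_zero, one_mul] at this
    exact h0.trans this
  exact nonneg_of_mul_nonneg_right hle (Real.exp_pos _)

/-- A Lipschitz real function varies by at most `K * r` between points at distance at most `r`. -/
theorem LipschitzWith.sub_le_mul_of_norm_sub_le {E : Type*} [SeminormedAddCommGroup E]
    {K : NNReal} {f : E → ℝ} (hf : LipschitzWith K f) {x z : E} {r : ℝ} (hr : ‖x - z‖ ≤ r) :
    |f x - f z| ≤ K * r := by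
  have := hf.norm_sub_le x z
  rw [Real.norm_eq_abs] at this
  exact this.trans (by gcongr)

/-- Theorem 2 (MRICBF safety): a controller satisfying the measurement-robust
incremental barrier condition at the corrupted measurement `q(x)`, with margins
`a(x) = (κ₁+κ₃+κ₄) e(x)` and `b(x) = κ₂ e(x)`, together with the compensation
condition on `σ` and `φ`, renders the closed-loop system
`y' = ydot₀(y) + B₀ k(q(y)) + σ(y)` forward invariant in `S = {x | h x ≥ 0}`. -/
theorem stmt_7 (p m : ℕ) (h : EuclideanSpace ℝ (Fin p) → ℝ)
    (hC : ContDiff ℝ 1 h)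
    (ydot₀ σ : EuclideanSpace ℝ (Fin p) → EuclideanSpace ℝ (Fin p))
    (B₀ : EuclideanSpace ℝ (Fin m) →L[ℝ] EuclideanSpace ℝ (Fin p))
    (φ : EuclideanSpace ℝ (Fin p) → ℝ)
    (γ : ℝ) (hγ : 0 ≤ γ)
    (L₁ : EuclideanSpace ℝ (Fin p) → ℝ)
    (L₂ : EuclideanSpace ℝ (Fin p) → (EuclideanSpace ℝ (Fin m) →L[ℝ] ℝ))
    (hL₁def : ∀ x, L₁ x = ⟪gradient h x, ydot₀ x⟫)
    (hL₂def : ∀ x, ∀ Δu, L₂ x Δu = ⟪gradient h x, B₀ Δu⟫)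
    (κ₁ κ₂ κ₃ κ₄ : NNReal)
    (hL₁ : LipschitzWith κ₁ L₁) (hL₂ : LipschitzWith κ₂ L₂)
    (hL₃ : LipschitzWith κ₃ φ)
    (hA : LipschitzWith κ₄ (fun x => γ * h x))
    (q : EuclideanSpace ℝ (Fin p) → EuclideanSpace ℝ (Fin p))
    (e : EuclideanSpace ℝ (Fin p) → ℝ)
    (herr : ∀ x, ‖q x - x‖ ≤ e x)
    (k : EuclideanSpace ℝ (Fin p) → EuclideanSpace ℝ (Fin m))
    (hk : ∀ x : EuclideanSpace ℝ (Fin p),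
      L₁ (q x) + L₂ (q x) (k (q x)) - φ (q x)
        - (↑κ₁ + ↑κ₃ + ↑κ₄) * e x - ↑κ₂ * e x * ‖k (q x)‖ ≥ -γ * h (q x))
    (hcomp : ∀ x : EuclideanSpace ℝ (Fin p), ⟪gradient h x, σ x⟫ + φ x ≥ 0) :
    ∀ y : ℝ → EuclideanSpace ℝ (Fin p),
      (∀ t : ℝ, 0 ≤ t →
        HasDerivAt y (ydot₀ (y t) + B₀ (k (q (y t))) + σ (y t)) t) →
      h (y 0) ≥ 0 →
      ∀ t : ℝ, 0 ≤ t → h (y t) ≥ 0 := by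
  intro y hy h0 t ht
  refine nonneg_of_hasDerivAt_ge_neg_mul_s7 (f := fun t => h (y t)) (γ := γ)
    (f' := fun t => ⟪gradient h (y t), ydot₀ (y t) + B₀ (k (q (y t))) + σ (y t)⟫)
    (fun s hs => ?_) (fun s _ => ?_) h0 ht
  · have hg := ((hC.differentiable one_ne_zero) (y s)).hasGradientAt.hasFDerivAt
    exact hg.comp_hasDerivAt s (hy s hs)
  · have hlip₁ := abs_le.1 (hL₁.sub_le_mul_of_norm_sub_le (herr (y s)))
    have hlip₃ := abs_le.1 (hL₃.sub_le_mul_of_norm_sub_le (herr (y s)))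
    have hlip₄ := abs_le.1 (hA.sub_le_mul_of_norm_sub_le (herr (y s)))
    have hlip₂ : |(L₂ (q (y s)) - L₂ (y s)) (k (q (y s)))| ≤
        κ₂ * e (y s) * ‖k (q (y s))‖ := by
      refine ((L₂ (q (y s)) - L₂ (y s)).le_opNorm (k (q (y s)))).trans ?_
      have := hL₂.norm_sub_le (q (y s)) (y s)
      gcongr
      exact this.trans (by gcongr; exact herr (y s))
    rw [sub_apply] at hlip₂
    have hbarrier := hk (y s)
    have hcomp' := hcomp (y s)
    simp only [inner_add_right, ← hL₁def, ← hL₂def]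
    linarith [hlip₁.2, hlip₃.1, hlip₄.2, (abs_le.1 hlip₂).2]
end
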